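/- arXiv:1404.2708 — 2 statements merged into one kernel-verified Lean document; each statement's English description precedes it below -/
import Mathlib

section
/- For every integer n ≥ 1, the linear span of all products T₀·[N,T₁]·[N,T₂]⋯[N,T_n] with T₀, T₁, …, T_n ∈ 𝒮 is equal to 𝒮. (In the language of the paper: for the spectral triple (𝒮, ℓ²(ℕ), N), the image π_N(Ω^n(𝒮)) of the universal n-forms equals 𝒮 for all n ≥ 1.) -/
noncomputable section

/-- `V` is the ℂ-vector space of finitely supported sequences `ℕ → ℂ`. -/
def V : Type := ℕ →₀ ℂ

instance : AddCommGroup V := inferInstanceAs (AddCommGroup (ℕ →₀ ℂ))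
instance : Module ℂ V := inferInstanceAs (Module ℂ (ℕ →₀ ℂ))

/-- The number operator `N`, determined by `N e_k = k e_k`. -/
def Nop : Module.End ℂ V := Finsupp.lsum ℂ fun k => (k : ℂ) • Finsupp.lsingle k

/-- The matrix unit `e_{ij}`, determined by `e_{ij} e_k = δ_{jk} e_i`. -/
def matUnit (i j : ℕ) : Module.End ℂ V := (Finsupp.lapply j).smulRight (Finsupp.single i 1)

/-- `𝒮`, the linear span of the matrix units (the finitely supported matrices). -/
def finS : Submodule ℂ (Module.End ℂ V) :=
  Submodule.span ℂ (Set.range fun p : ℕ × ℕ => matUnit p.1 p.2)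

/-- The commutator `[x, y] = x*y − y*x`. -/
def brkt {R : Type*} [Ring R] (x y : R) : R := x * y - y * x

/-- The `k`-th standard basis vector of `V`. -/
def stdVec (k : ℕ) : V := Finsupp.single k (1 : ℂ)

/-- The `k`-th coordinate functional on `V`. -/
def coordFun (k : ℕ) : V →ₗ[ℂ] ℂ := Finsupp.lapply (M := ℂ) (R := ℂ) k

theorem coordFun_stdVec (j k : ℕ) : coordFun j (stdVec k) = if k = j then 1 else 0 :=
  Finsupp.single_apply

theorem matUnit_apply (i j : ℕ) (v : V) : matUnit i j v = coordFun j v • stdVec i := rfl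

theorem Nop_stdVec (k : ℕ) : Nop (stdVec k) = (k : ℂ) • stdVec k := by
  refine (Finsupp.lsum_single ℂ (fun k : ℕ => (k : ℂ) • Finsupp.lsingle (M := ℂ) k) k 1).trans ?_
  rfl

theorem end_ext {f g : Module.End ℂ V} (h : ∀ k, f (stdVec k) = g (stdVec k)) : f = g :=
  Finsupp.lhom_ext' (M := ℂ) fun k => LinearMap.ext_ring (h k)

theorem matUnit_mul_matUnit (i j k l : ℕ) :
    matUnit i j * matUnit k l = if j = k then matUnit i l else 0 := by
  refine LinearMap.ext fun v => ?_
  rw [Module.End.mul_apply, matUnit_apply k l, map_smul, matUnit_apply, coordFun_stdVec]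
  by_cases h : j = k
  · simp [h, matUnit_apply]
  · simp [h, Ne.symm h]

theorem brkt_Nop_matUnit (i j : ℕ) :
    brkt Nop (matUnit i j) = ((i : ℂ) - j) • matUnit i j := by
  refine end_ext fun k => ?_
  simp only [brkt, LinearMap.sub_apply, Module.End.mul_apply, LinearMap.smul_apply, Nop_stdVec,
    matUnit_apply, map_smul, coordFun_stdVec]
  by_cases h : k = j
  · simp [h, sub_smul]
  · simp [h]

theorem matUnit_mem_finS (i j : ℕ) : matUnit i j ∈ finS :=
  Submodule.subset_span ⟨(i, j), rfl⟩

theorem mul_mem_finS {x y : Module.End ℂ V} (hx : x ∈ finS) (hy : y ∈ finS) :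
    x * y ∈ finS := by
  refine (Submodule.mul_le.1 ?_) x hx y hy
  rw [finS, Submodule.span_mul_span, Submodule.span_le]
  rintro _ ⟨_, ⟨p, rfl⟩, _, ⟨q, rfl⟩, rfl⟩
  simp only [matUnit_mul_matUnit]
  split_ifs
  · exact matUnit_mem_finS _ _
  · exact finS.zero_mem

theorem brkt_Nop_mem_finS {x : Module.End ℂ V} (hx : x ∈ finS) : brkt Nop x ∈ finS := by
  induction hx using Submodule.span_induction with
  | mem x hx =>
    obtain ⟨p, rfl⟩ := hx
    rw [brkt_Nop_matUnit]
    exact finS.smul_mem _ (matUnit_mem_finS _ _)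
  | zero => simp [brkt]
  | add x y _ _ hx hy =>
    have h : brkt Nop (x + y) = brkt Nop x + brkt Nop y := by unfold brkt; noncomm_ring
    exact h ▸ finS.add_mem hx hy
  | smul c x _ hx =>
    have h : brkt Nop (c • x) = c • brkt Nop x := by
      simp only [brkt, mul_smul_comm, smul_mul_assoc, smul_sub]
    exact h ▸ finS.smul_mem c hx

theorem mul_list_prod_mem_finS (l : List (Module.End ℂ V)) (hl : ∀ y ∈ l, y ∈ finS)
    {x : Module.End ℂ V} (hx : x ∈ finS) : x * l.prod ∈ finS := by
  induction l generalizing x with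
  | nil => simpa using hx
  | cons y l ih =>
    rw [List.prod_cons, ← mul_assoc]
    exact ih (fun z hz => hl z (List.mem_cons_of_mem _ hz))
      (mul_mem_finS hx (hl y List.mem_cons_self))

/-- Every matrix unit factors through `n` commutators along a descending staircase of indices. -/
theorem matUnit_mul_prod_brkt (n i j : ℕ) :
    matUnit i (j + n) *
      (List.ofFn fun a : Fin n => brkt Nop (matUnit (j + n - a) (j + n - a - 1))).prod =
      matUnit i j := by
  induction n with
  | zero => simp
  | succ n ih =>
    have h : brkt Nop (matUnit (j + n + 1) (j + n)) = matUnit (j + n + 1) (j + n) := by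
      simp [brkt_Nop_matUnit]
    have hs (a : Fin n) : j + (n + 1) - (a + 1) = j + n - a := by omega
    simp only [List.ofFn_succ, List.prod_cons, Fin.val_zero, Fin.val_succ, Nat.sub_zero, hs,
      ← mul_assoc]
    simp only [← Nat.add_assoc, Nat.add_sub_cancel, h, matUnit_mul_matUnit, if_true]
    exact ih

/-- For every `n ≥ 1`, the linear span of all products
`T₀ · [N,T₁] ⋯ [N,T_n]` with `T₀, …, T_n ∈ 𝒮` equals `𝒮`. -/
theorem stmt_0 (n : ℕ) (hn : 1 ≤ n) :
    Submodule.span ℂ {x : Module.End ℂ V |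
      ∃ (T0 : Module.End ℂ V) (T : Fin n → Module.End ℂ V),
        T0 ∈ finS ∧ (∀ i, T i ∈ finS) ∧
        x = T0 * (List.ofFn fun i => brkt Nop (T i)).prod} = finS := by
  refine le_antisymm (Submodule.span_le.2 ?_) (Submodule.span_le.2 ?_)
  · rintro _ ⟨T0, T, hT0, hT, rfl⟩
    refine mul_list_prod_mem_finS _ (fun y hy => ?_) hT0
    obtain ⟨a, rfl⟩ := (List.mem_ofFn' _ _).1 hy
    exact brkt_Nop_mem_finS (hT a)
  · rintro _ ⟨⟨i, j⟩, rfl⟩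
    exact Submodule.subset_span ⟨_, _, matUnit_mem_finS i (j + n),
      fun a => matUnit_mem_finS (j + n - a) (j + n - a - 1), (matUnit_mul_prod_brkt n i j).symm⟩
end
end

section
/- Let W be a complex vector space, D, F ∈ End(W), A ⊆ End(W) a unital subalgebra, and Σ²D := D⊗1 + F⊗N ∈ End(W⊗V). Then for every n ≥ 1, every j with 0 ≤ j ≤ n−1, all a, b₁, …, b_j ∈ A, and every i ∈ ℕ, there exist finitely many tuples (x_{0k}, x_{1k}, …, x_{nk}) of elements of A⊗𝒮 such that Σ_k x_{0k}·[Σ²D, x_{1k}]⋯[Σ²D, x_{nk}] = 0 while Σ_k [Σ²D, x_{0k}]·[Σ²D, x_{1k}]⋯[Σ²D, x_{nk}] = a F^{n+1−j}·[D,b₁]⋯[D,b_j] ⊗ e_{i0}. (This is an exact form of the paper's Lemma that Σ_{j=0}^{n} F^{n+1−j} π(Ω^j(𝒜))⊗𝒮 ⊆ π(dJ₀ⁿ(𝒜⊗𝒮)), with the sign-operator factors placed between a and the commutators.) -/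
open scoped TensorProduct

noncomputable section

variable {W : Type*} [AddCommGroup W] [Module ℂ W]

/-- `x ⊗ y` as an endomorphism of `W ⊗ V`, acting factorwise. -/
def tmul2 (x : Module.End ℂ W) (y : Module.End ℂ V) : Module.End ℂ (W ⊗[ℂ] V) :=
  TensorProduct.map x y

/-- `A ⊗ 𝒮` inside `End(W ⊗ V)`: the linear span of the operators `b ⊗ T` with
`b ∈ A` and `T ∈ 𝒮`. -/
def AtSgen (A : Subalgebra ℂ (Module.End ℂ W)) :
    Submodule ℂ (Module.End ℂ (W ⊗[ℂ] V)) :=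
  Submodule.span ℂ {x : Module.End ℂ (W ⊗[ℂ] V) |
    ∃ (b : Module.End ℂ W) (T : Module.End ℂ V), b ∈ A ∧ T ∈ finS ∧ x = tmul2 b T}

/-- The standard basis vector `e_k` of `V`. -/
def basisVec (k : ℕ) : V := Finsupp.single k (1 : ℂ)

theorem endV_ext {S T : Module.End ℂ V} (h : ∀ k, S (basisVec k) = T (basisVec k)) : S = T :=
  Finsupp.lhom_ext' (M := ℂ) (N := V) fun k => LinearMap.ext_ring (h k)

theorem matUnit_basisVec_self (p q : ℕ) : matUnit p q (basisVec q) = basisVec p := by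
  change (Finsupp.single q (1 : ℂ)) q • basisVec p = basisVec p
  rw [Finsupp.single_eq_same, one_smul]

theorem matUnit_basisVec_of_ne (p : ℕ) {q k : ℕ} (h : q ≠ k) :
    matUnit p q (basisVec k) = 0 := by
  change (Finsupp.single k (1 : ℂ)) q • basisVec p = 0
  rw [Finsupp.single_eq_of_ne h, zero_smul]

theorem Nop_basisVec (k : ℕ) : Nop (basisVec k) = (k : ℂ) • basisVec k :=
  Finsupp.lsum_single (M := ℂ) (N := V) ℂ (fun k : ℕ => (k : ℂ) • Finsupp.lsingle k) k 1

theorem matUnit_mul_matUnit_s14 (p q s : ℕ) : matUnit p q * matUnit q s = matUnit p s := by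
  refine endV_ext fun k => ?_
  obtain rfl | h := eq_or_ne s k
  · simp [matUnit_basisVec_self]
  · simp [matUnit_basisVec_of_ne _ h]

theorem Nop_mul_matUnit (p q : ℕ) : Nop * matUnit p q = (p : ℂ) • matUnit p q := by
  refine endV_ext fun k => ?_
  obtain rfl | h := eq_or_ne q k
  · simp [matUnit_basisVec_self, Nop_basisVec]
  · simp [matUnit_basisVec_of_ne _ h]

theorem matUnit_mul_Nop (p q : ℕ) : matUnit p q * Nop = (q : ℂ) • matUnit p q := by
  refine endV_ext fun k => ?_
  obtain rfl | h := eq_or_ne q k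
  · simp [Nop_basisVec]
  · simp [matUnit_basisVec_of_ne _ h, Nop_basisVec]

theorem tmul2_mul (x x' : Module.End ℂ W) (y y' : Module.End ℂ V) :
    tmul2 x y * tmul2 x' y' = tmul2 (x * x') (y * y') :=
  (TensorProduct.map_comp x y x' y').symm

theorem tmul2_add_left (x x' : Module.End ℂ W) (y : Module.End ℂ V) :
    tmul2 (x + x') y = tmul2 x y + tmul2 x' y :=
  TensorProduct.map_add_left x x' y

theorem tmul2_smul_left (c : ℂ) (x : Module.End ℂ W) (y : Module.End ℂ V) :
    tmul2 (c • x) y = c • tmul2 x y :=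
  TensorProduct.map_smul_left c x y

theorem tmul2_smul_right (c : ℂ) (x : Module.End ℂ W) (y : Module.End ℂ V) :
    tmul2 x (c • y) = c • tmul2 x y :=
  TensorProduct.map_smul_right c x y

theorem tmul2_sub_left (x x' : Module.End ℂ W) (y : Module.End ℂ V) :
    tmul2 (x - x') y = tmul2 x y - tmul2 x' y := by
  rw [eq_sub_iff_add_eq, ← tmul2_add_left, sub_add_cancel]

theorem tmul2_matUnit_mem_AtSgen {A : Subalgebra ℂ (Module.End ℂ W)} {c : Module.End ℂ W}
    (hc : c ∈ A) (p q : ℕ) : tmul2 c (matUnit p q) ∈ AtSgen A :=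
  Submodule.subset_span ⟨c, matUnit p q, hc, Submodule.subset_span ⟨(p, q), rfl⟩, rfl⟩

theorem brkt_tmul2_matUnit (D F c : Module.End ℂ W) (p q : ℕ) :
    brkt (tmul2 D 1 + tmul2 F Nop) (tmul2 c (matUnit p q)) =
      tmul2 (brkt D c + (p : ℂ) • (F * c) - (q : ℂ) • (c * F)) (matUnit p q) := by
  simp only [brkt, add_mul, mul_add, tmul2_mul, one_mul, mul_one, Nop_mul_matUnit,
    matUnit_mul_Nop, tmul2_add_left, tmul2_sub_left, tmul2_smul_left, tmul2_smul_right]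
  abel

theorem brkt_tmul2_one_matUnit (D F : Module.End ℂ W) (p q : ℕ) :
    brkt (tmul2 D 1 + tmul2 F Nop) (tmul2 1 (matUnit p q)) =
      tmul2 (((p : ℂ) - q) • F) (matUnit p q) := by
  rw [brkt_tmul2_matUnit, sub_smul]
  simp [brkt]

theorem tmul2_matUnit_mul_prod_brkt (D F : Module.End ℂ W) (p : ℕ) {j : ℕ}
    (b : Fin j → Module.End ℂ W) (c : Module.End ℂ W) :
    tmul2 c (matUnit p 0) *
        (List.ofFn fun m =>
          brkt (tmul2 D 1 + tmul2 F Nop) (tmul2 (b m) (matUnit 0 0))).prod =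
      tmul2 (c * (List.ofFn fun m => brkt D (b m)).prod) (matUnit p 0) := by
  induction j generalizing c with
  | zero => simp
  | succ j ih =>
    rw [List.ofFn_succ, List.prod_cons, ← mul_assoc, brkt_tmul2_matUnit, tmul2_mul,
      matUnit_mul_matUnit_s14, ih, List.ofFn_succ, List.prod_cons, mul_assoc]
    simp

/-- Elements of `A ⊗ 𝒮` whose commutators with `Σ²D` realise `F ^ r * [D, b₁] ⋯ [D, b_j]`
along a path of matrix units from `r` to `0`. -/
theorem exists_prod_brkt_eq (D F : Module.End ℂ W) {A : Subalgebra ℂ (Module.End ℂ W)} {j : ℕ}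
    {b : Fin j → Module.End ℂ W} (hb : ∀ m, b m ∈ A) (r : ℕ) {n : ℕ} (hn : n = r + j) :
    ∃ y : Fin n → Module.End ℂ (W ⊗[ℂ] V), (∀ m, y m ∈ AtSgen A) ∧
      ∀ (c : Module.End ℂ W) (p : ℕ),
        tmul2 c (matUnit p r) *
            (List.ofFn fun m => brkt (tmul2 D 1 + tmul2 F Nop) (y m)).prod =
          tmul2 (c * F ^ r * (List.ofFn fun m => brkt D (b m)).prod) (matUnit p 0) := by
  induction r generalizing n with
  | zero =>
    obtain rfl : n = j := by omega
    refine ⟨fun m => tmul2 (b m) (matUnit 0 0), fun m => tmul2_matUnit_mem_AtSgen (hb m) 0 0,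
      fun c p => ?_⟩
    rw [tmul2_matUnit_mul_prod_brkt, pow_zero, mul_one]
  | succ r ih =>
    obtain ⟨m, rfl⟩ : ∃ m, n = m + 1 := ⟨r + j, by omega⟩
    obtain ⟨y, hy, hprod⟩ := ih (n := m) (by omega)
    refine ⟨Fin.cons (tmul2 1 (matUnit (r + 1) r)) y,
      fun k => Fin.cases (tmul2_matUnit_mem_AtSgen A.one_mem _ _) hy k, fun c p => ?_⟩
    rw [List.ofFn_succ, List.prod_cons, ← mul_assoc]
    simp only [Fin.cons_zero, Fin.cons_succ]
    rw [brkt_tmul2_one_matUnit, tmul2_mul, matUnit_mul_matUnit_s14, hprod, pow_succ']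
    simp [mul_assoc]

/-- With `Σ²D = D⊗1 + F⊗N` on `W ⊗ V`: for every `n ≥ 1`, every `0 ≤ j ≤ n−1`,
all `a, b₁, …, b_j ∈ A` and every `i ∈ ℕ`, there are finitely many tuples
`(x₀ₖ, …, x_{nk})` of elements of `A⊗𝒮` with
`Σₖ x₀ₖ·[Σ²D,x₁ₖ]⋯[Σ²D,x_{nk}] = 0` and
`Σₖ [Σ²D,x₀ₖ]·[Σ²D,x₁ₖ]⋯[Σ²D,x_{nk}] = a F^{n+1−j}·[D,b₁]⋯[D,b_j] ⊗ e_{i0}`. -/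
theorem stmt_14 (D F : Module.End ℂ W) (A : Subalgebra ℂ (Module.End ℂ W))
    (n j : ℕ) (hn : 1 ≤ n) (hj : j ≤ n - 1)
    (a : Module.End ℂ W) (ha : a ∈ A)
    (b : Fin j → Module.End ℂ W) (hb : ∀ m, b m ∈ A) (i : ℕ) :
    ∃ (K : ℕ) (x0 : Fin K → Module.End ℂ (W ⊗[ℂ] V))
      (xr : Fin K → Fin n → Module.End ℂ (W ⊗[ℂ] V)),
      (∀ k, x0 k ∈ AtSgen A) ∧ (∀ k i', xr k i' ∈ AtSgen A) ∧
      (∑ k, x0 k *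
        (List.ofFn fun i' => brkt (tmul2 D 1 + tmul2 F Nop) (xr k i')).prod = 0) ∧
      (∑ k, brkt (tmul2 D 1 + tmul2 F Nop) (x0 k) *
          (List.ofFn fun i' => brkt (tmul2 D 1 + tmul2 F Nop) (xr k i')).prod
        = tmul2 (a * F ^ (n + 1 - j) * (List.ofFn fun m => brkt D (b m)).prod)
            (matUnit i 0)) := by
  obtain ⟨m, rfl⟩ : ∃ m, n = m + 1 := ⟨n - 1, by omega⟩
  obtain ⟨r, rfl⟩ : ∃ r, m = r + j := ⟨m - j, by omega⟩
  obtain ⟨y, hy, hprod⟩ := exists_prod_brkt_eq D F hb r rfl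
  have hpath (c : Module.End ℂ W) (q p : ℕ) :
      tmul2 c (matUnit q p) * (List.ofFn fun m =>
          brkt (tmul2 D 1 + tmul2 F Nop)
            ((Fin.cons (tmul2 1 (matUnit p r)) y : Fin (r + j + 1) → _) m)).prod =
        ((p : ℂ) - r) • tmul2 (c * F ^ (r + 1) * (List.ofFn fun m => brkt D (b m)).prod)
          (matUnit q 0) := by
    rw [List.ofFn_succ, List.prod_cons, ← mul_assoc]
    simp only [Fin.cons_zero, Fin.cons_succ]
    rw [brkt_tmul2_one_matUnit, tmul2_mul, matUnit_mul_matUnit_s14, hprod, pow_succ',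
      ← tmul2_smul_left]
    simp [mul_assoc]
  refine ⟨2, ![tmul2 a (matUnit i (r + 1)), (-(1 / 2) : ℂ) • tmul2 a (matUnit i (r + 2))],
    fun k => Fin.cons (tmul2 1 (matUnit (![r + 1, r + 2] k) r)) y, ?_, fun k => ?_, ?_, ?_⟩
  · exact Fin.forall_fin_two.2 ⟨tmul2_matUnit_mem_AtSgen ha _ _,
      Submodule.smul_mem _ _ (tmul2_matUnit_mem_AtSgen ha _ _)⟩
  · exact Fin.cases (tmul2_matUnit_mem_AtSgen A.one_mem _ _) hy
  · rw [Fin.sum_univ_two]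
    simp only [Matrix.cons_val_zero, Matrix.cons_val_one, smul_mul_assoc, hpath]
    push_cast
    module
  · rw [Fin.sum_univ_two]
    simp only [Matrix.cons_val_zero, Matrix.cons_val_one]
    rw [← tmul2_smul_left, brkt_tmul2_matUnit, brkt_tmul2_matUnit, hpath, hpath,
      show r + j + 1 + 1 - j = r + 2 by omega, pow_succ' F (r + 1)]
    simp only [brkt, sub_mul, add_mul, smul_mul_assoc, mul_smul_comm, smul_sub, tmul2_add_left,
      tmul2_sub_left, tmul2_smul_left, mul_assoc]
    push_cast
    module
end
end
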